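/- Let H(x,p) = a(x)K(p), where K : ℝⁿ → ℝ is continuous with K(0) = 0, a : ℝⁿ → ℝ is bounded and uniformly continuous with 0 < α ≤ a(x) ≤ β for all x ∈ ℝⁿ for some constants α, β > 0, and H satisfies (H1), (H2), (H3c) and (H4). For each k ∈ ℕ let u_k be the unique Lipschitz state-constraint viscosity solution of u_k(x) + a(x)K(Du_k(x)) = 0 on B(0,k). Then there exists a constant C > 0 depending only on H such that 0 ≤ u_k(x) ≤ C e^{(|x| − k)/C} for every k and every x in the closure of B(0,k). In particular, since u ≡ 0 is the unique bounded viscosity solution of u + a(x)K(Du) = 0 in ℝⁿ, u_k converges to u locally uniformly with exponential rate: for every R > 0, 0 ≤ u_k(x) ≤ (C e^{R/C}) e^{−k/C} for all |x| ≤ R and k ≥ R. -/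

import Mathlib

open Metric Set MeasureTheory Filter
open scoped Topology NNReal RealInnerProductSpace

noncomputable section

abbrev Euc (n : ℕ) := EuclideanSpace ℝ (Fin n)

/-- `v` is a viscosity subsolution of `v + H(x, Dv) = 0` in the open set `Ω`. -/
def IsViscositySubsolutionIn {n : ℕ} (Ω : Set (Euc n)) (H : Euc n → Euc n → ℝ)
    (v : Euc n → ℝ) : Prop :=
  ∀ x ∈ Ω, ∀ φ : Euc n → ℝ, ContDiff ℝ 1 φ →
    IsLocalMaxOn (fun y => v y - φ y) Ω x → v x + H x (gradient φ x) ≤ 0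

/-- `v` is a viscosity supersolution of `v + H(x, Dv) = 0` on the closure of `Ω`. -/
def IsViscositySupersolutionOn {n : ℕ} (Ω : Set (Euc n)) (H : Euc n → Euc n → ℝ)
    (v : Euc n → ℝ) : Prop :=
  ∀ x ∈ closure Ω, ∀ φ : Euc n → ℝ, ContDiff ℝ 1 φ →
    IsLocalMinOn (fun y => v y - φ y) (closure Ω) x → 0 ≤ v x + H x (gradient φ x)

/-- `v` is a state-constraint viscosity solution on `Ω`. -/
def IsStateConstraintSolution {n : ℕ} (Ω : Set (Euc n)) (H : Euc n → Euc n → ℝ)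
    (v : Euc n → ℝ) : Prop :=
  ContinuousOn v (closure Ω) ∧ IsViscositySubsolutionIn Ω H v ∧
    IsViscositySupersolutionOn Ω H v

lemma aux_norm_gradient {n : ℕ} (φ : Euc n → ℝ) (x : Euc n) (f' : Euc n →L[ℝ] ℝ)
    (h : HasFDerivAt φ f' x) : ‖gradient φ x‖ = ‖f'‖ := by
  rw [gradient, h.fderiv, LinearIsometryEquiv.norm_map]

/-- The barrier function. -/
def auxBarrier {n : ℕ} (M L κ : ℝ) (x : Euc n) : ℝ :=
  M * Real.exp ((Real.sqrt (1 + ‖x‖ ^ 2) - κ) / L)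

lemma auxBarrier_contDiff {n : ℕ} (M L κ : ℝ) :
    ContDiff ℝ 1 (auxBarrier M L κ : Euc n → ℝ) := by
  unfold auxBarrier
  refine contDiff_const.mul (Real.contDiff_exp.comp ?_)
  refine ContDiff.div_const (ContDiff.sub (ContDiff.sqrt ?_ ?_) contDiff_const) L
  · exact contDiff_const.add (contDiff_norm_sq ℝ)
  · intro x
    positivity

lemma auxBarrier_gradient {n : ℕ} (M L κ : ℝ) (hM : 0 ≤ M) (hL : 0 < L) (x : Euc n) :
    L * ‖gradient (auxBarrier M L κ) x‖ ≤ auxBarrier M L κ x := by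
  have hpos : (0:ℝ) < 1 + ‖x‖ ^ 2 := by positivity
  have h1 : HasFDerivAt (fun y : Euc n => 1 + ‖y‖ ^ 2) (2 • innerSL ℝ x) x :=
    (hasStrictFDerivAt_norm_sq x).hasFDerivAt.const_add 1
  have h2 := (((h1.sqrt hpos.ne').sub_const κ).mul_const (L⁻¹)).exp.const_mul M
  have hfun : (auxBarrier M L κ : Euc n → ℝ) =
      fun y => M * Real.exp ((Real.sqrt (1 + ‖y‖ ^ 2) - κ) * L⁻¹) := by
    funext y
    rw [auxBarrier, div_eq_mul_inv]
  have h3 := h2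
  rw [← hfun] at h3
  rw [aux_norm_gradient _ _ _ h3]
  have hs : 0 < Real.sqrt (1 + ‖x‖ ^ 2) := Real.sqrt_pos.2 hpos
  have hxs : ‖x‖ ≤ Real.sqrt (1 + ‖x‖ ^ 2) := Real.le_sqrt_of_sq_le (by linarith)
  have h2n : ‖(2:ℕ) • innerSL ℝ x‖ = 2 * ‖x‖ := by
    rw [two_smul, ← two_smul ℝ, norm_smul, innerSL_apply_norm]; norm_num
  rw [norm_smul, norm_smul, norm_smul, norm_smul, h2n]
  simp only [Real.norm_eq_abs]
  rw [abs_of_nonneg hM, abs_of_pos (Real.exp_pos _), abs_of_pos (inv_pos.2 hL),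
    abs_of_pos (by positivity)]
  unfold auxBarrier
  rw [div_eq_mul_inv _ L]
  set s := Real.sqrt (1 + ‖x‖ ^ 2)
  set e := Real.exp ((s - κ) * L⁻¹)
  have he : 0 < e := Real.exp_pos _
  have : L * (M * (e * (L⁻¹ * (1 / (2 * s) * (2 * ‖x‖))))) = (M * e) * (‖x‖ / s) := by
    field_simp
  rw [this]
  exact mul_le_of_le_one_right (by positivity) ((div_le_one hs).2 hxs)

/-- Nonnegativity of supersolutions. -/
lemma aux_nonneg {n : ℕ} (k : ℝ) (hk : 0 < k) (H : Euc n → Euc n → ℝ)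
    (hH : ∀ x, H x 0 = 0) (u : Euc n → ℝ)
    (hu : IsStateConstraintSolution (ball (0 : Euc n) k) H u) :
    ∀ x ∈ closure (ball (0 : Euc n) k), 0 ≤ u x := by
  obtain ⟨hc, -, hsup⟩ := hu
  have hcomp : IsCompact (closure (ball (0 : Euc n) k)) := isBounded_ball.isCompact_closure
  obtain ⟨x0, hx0, hmin⟩ :=
    hcomp.exists_isMinOn ⟨0, subset_closure (mem_ball_self hk)⟩ hc
  have h := hsup x0 hx0 (fun _ => 0) contDiff_const (by
    have := hmin.localize
    simpa using this)
  have hg : gradient (fun _ : Euc n => (0:ℝ)) x0 = 0 := by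
    simp [gradient]
  rw [hg, hH, add_zero] at h
  intro x hx
  exact h.trans (hmin hx)

/-- Bound from above. -/
lemma aux_le {n : ℕ} (k : ℝ) (hk : 0 < k) (H : Euc n → Euc n → ℝ)
    (C : ℝ) (hH : ∀ x p, -(H x p) ≤ C) (u : Euc n → ℝ)
    (hu : IsStateConstraintSolution (ball (0 : Euc n) k) H u)
    (hnn : ∀ x ∈ closure (ball (0 : Euc n) k), 0 ≤ u x) :
    ∀ x ∈ closure (ball (0 : Euc n) k), u x ≤ C := by
  obtain ⟨hc, hsub, -⟩ := hu
  have hcomp : IsCompact (closure (ball (0 : Euc n) k)) := isBounded_ball.isCompact_closure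
  have hne : (closure (ball (0 : Euc n) k)).Nonempty := ⟨0, subset_closure (mem_ball_self hk)⟩
  obtain ⟨x1, hx1, hmax1⟩ := hcomp.exists_isMaxOn hne hc
  have hint : ∀ x ∈ ball (0 : Euc n) k, u x ≤ C := by
    intro x0 hx0
    obtain ⟨r, hr, hrb⟩ := Metric.isOpen_iff.1 isOpen_ball x0 hx0
    set N : ℝ := (u x1 + 1) / r ^ 2 with hN
    have hB : 0 ≤ u x1 := hnn x1 hx1
    have hNpos : 0 < N := by positivity
    have hcd : ContDiff ℝ 1 (fun y : Euc n => N * ‖y - x0‖ ^ 2) :=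
      contDiff_const.mul ((contDiff_id.sub contDiff_const).norm_sq ℝ)
    obtain ⟨y, hy, hmax⟩ := hcomp.exists_isMaxOn hne
      (hc.sub hcd.continuous.continuousOn)
    have h0 : u x0 - N * ‖x0 - x0‖ ^ 2 ≤ u y - N * ‖y - x0‖ ^ 2 := hmax (subset_closure hx0)
    have h00 := hnn x0 (subset_closure hx0)
    have hy1 : u y ≤ u x1 := hmax1 hy
    simp only [sub_self, norm_zero] at h0
    have hyb : y ∈ ball x0 r := by
      rw [mem_ball, dist_eq_norm]
      by_contra hcon
      push Not at hcon
      have h1 : r ^ 2 ≤ ‖y - x0‖ ^ 2 := by gcongr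
      have h2 : N * r ^ 2 ≤ N * ‖y - x0‖ ^ 2 := by gcongr
      have h3 : N * r ^ 2 = u x1 + 1 := by rw [hN]; field_simp
      linarith
    have hs := hsub y (hrb hyb) _ hcd ((hmax.on_subset subset_closure).localize)
    have h1 := hH y (gradient (fun y : Euc n => N * ‖y - x0‖ ^ 2) y)
    have h2 : 0 ≤ N * ‖y - x0‖ ^ 2 := by positivity
    linarith
  intro x hx
  exact le_on_closure hint hc continuousOn_const hx

lemma aux_main {n : ℕ} (k : ℝ) (hk : 0 < k) (H : Euc n → Euc n → ℝ)
    (C L : ℝ) (hC : 0 ≤ C) (hL : 0 < L) (hH0 : ∀ x, H x 0 = 0) (hH : ∀ x p, -(H x p) ≤ C)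
    (hHL : ∀ x p, H x p ≤ 0 → -(H x p) ≤ L * ‖p‖) (u : Euc n → ℝ)
    (hu : IsStateConstraintSolution (ball (0 : Euc n) k) H u) :
    ∀ x ∈ closure (ball (0 : Euc n) k), u x ≤ auxBarrier C L k x := by
  have hnn := aux_nonneg k hk H hH0 u hu
  have hle := aux_le k hk H C hH u hu hnn
  obtain ⟨hc, hsub, -⟩ := hu
  have hcomp : IsCompact (closure (ball (0 : Euc n) k)) := isBounded_ball.isCompact_closure
  have hne : (closure (ball (0 : Euc n) k)).Nonempty := ⟨0, subset_closure (mem_ball_self hk)⟩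
  have hcd : ContDiff ℝ 1 (auxBarrier C L k : Euc n → ℝ) := auxBarrier_contDiff C L k
  obtain ⟨y, hy, hmax⟩ := hcomp.exists_isMaxOn hne (hc.sub hcd.continuous.continuousOn)
  have key : u y ≤ auxBarrier C L k y := by
    by_cases hyb : y ∈ ball (0 : Euc n) k
    · have hs := hsub y hyb _ hcd ((hmax.on_subset subset_closure).localize)
      have h0 := hnn y hy
      have h1 := hHL y _ (by linarith : H y (gradient (auxBarrier C L k) y) ≤ 0)
      have h2 := auxBarrier_gradient C L k hC hL y
      linarith
    · rw [mem_ball_zero_iff, not_lt] at hyb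
      refine (hle y hy).trans ?_
      unfold auxBarrier
      refine le_mul_of_one_le_right hC (Real.one_le_exp (div_nonneg ?_ hL.le))
      have : ‖y‖ ≤ Real.sqrt (1 + ‖y‖ ^ 2) := Real.le_sqrt_of_sq_le (by linarith)
      linarith
  intro x hx
  have : u x - auxBarrier C L k x ≤ u y - auxBarrier C L k y := hmax hx
  linarith

/-- Theorem 1.2: optimal exponential rate for nonconvex Hamiltonians of the form
`H(x,p) = a(x) K(p)` with `K(0) = 0` and `0 < α ≤ a ≤ β`, on `Ω_k = B(0,k)`. -/
theorem rate_exponential_aK {n : ℕ}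
    (K : Euc n → ℝ) (hKcont : Continuous K) (hK0 : K 0 = 0)
    (a : Euc n → ℝ) (haUC : UniformContinuous a) (haBdd : ∃ M : ℝ, ∀ x, |a x| ≤ M)
    (α β : ℝ) (hα : 0 < α) (ha : ∀ x : Euc n, α ≤ a x ∧ a x ≤ β)
    (C₁ : ℝ) (hC₁ : 0 < C₁) (hH1 : ∀ x p : Euc n, -(a x * K p) ≤ C₁)
    (C₂ : ℝ) (hC₂ : 0 < C₂) (hH2 : ∀ x : Euc n, |a x * K 0| ≤ C₂)
    (hH3c : ∀ R > (0:ℝ), ∃ C > (0:ℝ), ∀ x y p q : Euc n, ‖p‖ ≤ R → ‖q‖ ≤ R →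
      |a x * K p - a y * K p| ≤ C * ‖x - y‖ ∧ |a x * K p - a x * K q| ≤ C * ‖p - q‖)
    (hH4 : ∀ M : ℝ, ∃ R : ℝ, ∀ p : Euc n, R ≤ ‖p‖ → ∀ x : Euc n, M ≤ a x * K p)
    (uk : ℕ → Euc n → ℝ) (Lip : ℝ≥0)
    (huk : ∀ k : ℕ, 1 ≤ k →
      IsStateConstraintSolution (ball (0 : Euc n) (k : ℝ)) (fun x p => a x * K p) (uk k) ∧
      LipschitzOnWith Lip (uk k) (closure (ball (0 : Euc n) (k : ℝ)))) :
    ∃ C > (0:ℝ),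
      (∀ k : ℕ, 1 ≤ k → ∀ x ∈ closure (ball (0 : Euc n) (k : ℝ)),
        0 ≤ uk k x ∧ uk k x ≤ C * Real.exp ((‖x‖ - (k : ℝ)) / C)) ∧
      (∀ R > (0:ℝ), ∀ k : ℕ, R ≤ (k : ℝ) → ∀ x : Euc n, ‖x‖ ≤ R →
        0 ≤ uk k x ∧ uk k x ≤ (C * Real.exp (R / C)) * Real.exp (-(k : ℝ) / C)) := by
  obtain ⟨R0, hR0⟩ := hH4 1
  obtain ⟨L, hL, hLip⟩ := hH3c (max R0 1) (lt_max_of_lt_right one_pos)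
  have hH0 : ∀ x : Euc n, a x * K 0 = 0 := fun x => by rw [hK0, mul_zero]
  have hHL : ∀ x p : Euc n, a x * K p ≤ 0 → -(a x * K p) ≤ L * ‖p‖ := by
    intro x p hp
    have hpR : ‖p‖ ≤ max R0 1 := by
      by_contra hcon
      push Not at hcon
      have := hR0 p ((le_max_left _ _).trans hcon.le) x
      linarith
    have h := (hLip x x p 0 hpR (by simp)).2
    rw [hH0, sub_zero, sub_zero] at h
    exact (neg_le_abs _).trans h
  set C := max L (C₁ * Real.exp (1 / L)) with hCdef
  have hC : 0 < C := lt_max_of_lt_left hL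
  have main : ∀ k : ℕ, 1 ≤ k → ∀ x ∈ closure (ball (0 : Euc n) (k : ℝ)),
        0 ≤ uk k x ∧ uk k x ≤ C * Real.exp ((‖x‖ - (k : ℝ)) / C) := by
    intro k hk x hx
    have hk0 : (0:ℝ) < k := by exact_mod_cast hk
    have hu := (huk k hk).1
    refine ⟨aux_nonneg k hk0 _ hH0 _ hu x hx, ?_⟩
    have h := aux_main k hk0 _ C₁ L hC₁.le hL hH0 hH1 hHL _ hu x hx
    refine h.trans ?_
    have hxk : ‖x‖ ≤ k := by
      have := closure_ball_subset_closedBall hx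
      simpa using this
    have hs : Real.sqrt (1 + ‖x‖ ^ 2) ≤ 1 + ‖x‖ :=
      Real.sqrt_le_iff.2 ⟨by positivity, by nlinarith [norm_nonneg x]⟩
    have hLC : (‖x‖ - k) / L ≤ (‖x‖ - k) / C := by
      have : (k - ‖x‖) / C ≤ (k - ‖x‖) / L :=
        div_le_div_of_nonneg_left (by linarith) hL (le_max_left _ _)
      have e1 : (‖x‖ - k) / L = -((k - ‖x‖) / L) := by ring
      have e2 : (‖x‖ - k) / C = -((k - ‖x‖) / C) := by ring
      linarith
    unfold auxBarrier
    calc C₁ * Real.exp ((Real.sqrt (1 + ‖x‖ ^ 2) - k) / L)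
        ≤ C₁ * Real.exp ((1 + ‖x‖ - k) / L) := by gcongr
      _ = (C₁ * Real.exp (1 / L)) * Real.exp ((‖x‖ - k) / L) := by
          rw [mul_assoc, ← Real.exp_add]; congr 2; ring
      _ ≤ C * Real.exp ((‖x‖ - k) / C) := by
          gcongr
          exact le_max_right _ _
  refine ⟨C, hC, main, ?_⟩
  intro R hR k hRk x hxR
  have hk0 : (0:ℝ) < k := hR.trans_le hRk
  have hk : 1 ≤ k := by exact_mod_cast hk0
  have hx : x ∈ closure (ball (0 : Euc n) (k : ℝ)) := by
    rw [closure_ball _ hk0.ne']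
    simpa using hxR.trans hRk
  obtain ⟨h1, h2⟩ := main k hk x hx
  refine ⟨h1, h2.trans ?_⟩
  rw [mul_assoc, ← Real.exp_add, ← add_div]
  gcongr
  linarith
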